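/- Define real functions on the interval (−1,1) by F₁(x) = Σ_{n odd} f(n)·xⁿ/n!, F₂(x) = Σ_{n even} f(n)·xⁿ/n!, G₁(x) = Σ_{n odd} g(n)·xⁿ/n!, G₂(x) = Σ_{n even} g(n)·xⁿ/n! (all series converge for |x| < 1). Then for every x ∈ (−1,1): F₁′(x) = F₂(x)², F₂′(x) = F₁(x)·F₂(x) + G₁(x), G₁′(x) = F₂(x)·(F₂(x) − G₂(x)) + F₂(x), and G₂′(x) = F₂(x)·(F₁(x) − G₁(x)) + G₁(x), with F₁(0)=G₁(0)=0 and F₂(0)=G₂(0)=1. -/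

import Mathlib

/-- The entry of the permutation `σ` of `[n]` at (1-based) position `i`,
as a value in `{1, …, n}`; `0` if `i` is out of range. -/
def permEnt {n : ℕ} (σ : Equiv.Perm (Fin n)) (i : ℕ) : ℕ :=
  if h : 1 ≤ i ∧ i ≤ n then (σ ⟨i - 1, by omega⟩ : ℕ) + 1 else 0

/-- `i` is a descent of `σ`: `1 ≤ i ≤ n−1` and `π_i > π_{i+1}`. -/
def IsDescent {n : ℕ} (σ : Equiv.Perm (Fin n)) (i : ℕ) : Prop :=
  1 ≤ i ∧ i < n ∧ permEnt σ (i + 1) < permEnt σ i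

/-- `i` is an alternating descent of `σ`: `i` odd with `π_i > π_{i+1}`,
or `i` even with `π_i < π_{i+1}`. -/
def IsAltDescent {n : ℕ} (σ : Equiv.Perm (Fin n)) (i : ℕ) : Prop :=
  1 ≤ i ∧ i < n ∧
    ((i % 2 = 1 ∧ permEnt σ (i + 1) < permEnt σ i) ∨
     (i % 2 = 0 ∧ permEnt σ i < permEnt σ (i + 1)))

instance {n : ℕ} (σ : Equiv.Perm (Fin n)) (i : ℕ) : Decidable (IsDescent σ i) := by
  unfold IsDescent; infer_instance

instance {n : ℕ} (σ : Equiv.Perm (Fin n)) (i : ℕ) : Decidable (IsAltDescent σ i) := by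
  unfold IsAltDescent; infer_instance

/-- `i` is a peak of `σ`: `2 ≤ i ≤ n−1` and `π_{i−1} < π_i > π_{i+1}`. -/
def IsPeak {n : ℕ} (σ : Equiv.Perm (Fin n)) (i : ℕ) : Prop :=
  2 ≤ i ∧ i < n ∧ permEnt σ (i - 1) < permEnt σ i ∧ permEnt σ (i + 1) < permEnt σ i

/-- `i` is a valley of `σ`: `2 ≤ i ≤ n−1` and `π_{i−1} > π_i < π_{i+1}`. -/
def IsValley {n : ℕ} (σ : Equiv.Perm (Fin n)) (i : ℕ) : Prop :=
  2 ≤ i ∧ i < n ∧ permEnt σ i < permEnt σ (i - 1) ∧ permEnt σ i < permEnt σ (i + 1)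

/-- All valleys of `σ` are even and all peaks of `σ` are odd. -/
def GoodPerm {n : ℕ} (σ : Equiv.Perm (Fin n)) : Prop :=
  (∀ i, IsValley σ i → i % 2 = 0) ∧ (∀ i, IsPeak σ i → i % 2 = 1)

/-- `f n` is the number of permutations of `[n]` with all valleys even and all peaks odd. -/
noncomputable def fCount (n : ℕ) : ℕ :=
  Nat.card {σ : Equiv.Perm (Fin n) // GoodPerm σ}

/-- `g n` is the number of permutations of `[n]` with all valleys even and all peaks odd
having no descent at position `n − 1`. -/
noncomputable def gCount (n : ℕ) : ℕ :=
  Nat.card {σ : Equiv.Perm (Fin n) // GoodPerm σ ∧ ¬ IsDescent σ (n - 1)}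

/-- `σ` is an alternating permutation: `π₁ > π₂ < π₃ > π₄ < ⋯`. -/
def IsAltPerm {n : ℕ} (σ : Equiv.Perm (Fin n)) : Prop :=
  ∀ i, 1 ≤ i → i < n →
    (i % 2 = 1 → permEnt σ (i + 1) < permEnt σ i) ∧
    (i % 2 = 0 → permEnt σ i < permEnt σ (i + 1))

/-- The Euler number `Eₙ`, the number of alternating permutations of `[n]`. -/
noncomputable def eulerNum (n : ℕ) : ℕ :=
  Nat.card {σ : Equiv.Perm (Fin n) // IsAltPerm σ}

/-- `F₁(x) = Σ_{n odd} f(n)·xⁿ/n!` -/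
noncomputable def F1 (x : ℝ) : ℝ :=
  ∑' n : ℕ, (if n % 2 = 1 then (fCount n : ℝ) else 0) * x ^ n / n.factorial

/-- `F₂(x) = Σ_{n even} f(n)·xⁿ/n!` -/
noncomputable def F2 (x : ℝ) : ℝ :=
  ∑' n : ℕ, (if n % 2 = 0 then (fCount n : ℝ) else 0) * x ^ n / n.factorial

/-- `G₁(x) = Σ_{n odd} g(n)·xⁿ/n!` -/
noncomputable def G1 (x : ℝ) : ℝ :=
  ∑' n : ℕ, (if n % 2 = 1 then (gCount n : ℝ) else 0) * x ^ n / n.factorial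

/-- `G₂(x) = Σ_{n even} g(n)·xⁿ/n!` -/
noncomputable def G2 (x : ℝ) : ℝ :=
  ∑' n : ℕ, (if n % 2 = 0 then (gCount n : ℝ) else 0) * x ^ n / n.factorial

/-- Parity condition on peaks and valleys of the word `w 0, …, w (len-1)`. -/
def GoodW (p len : ℕ) (w : ℕ → ℕ) : Prop :=
  ∀ i, i + 2 < len →
    ((i + p) % 2 = 0 → ¬ (w i < w (i+1) ∧ w (i+2) < w (i+1))) ∧
    ((i + p) % 2 = 1 → ¬ (w (i+1) < w i ∧ w (i+1) < w (i+2)))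

/-- The word ends with a descent. -/
def EndDesc (len : ℕ) (w : ℕ → ℕ) : Prop := 2 ≤ len ∧ w (len - 1) < w (len - 2)

/-- The word ends with an ascent. -/
def EndAsc (len : ℕ) (w : ℕ → ℕ) : Prop := 2 ≤ len ∧ w (len - 2) < w (len - 1)

theorem goodW_congr {p len : ℕ} {w v : ℕ → ℕ} (h : ∀ i < len, w i = v i) :
    GoodW p len w ↔ GoodW p len v := by
  unfold GoodW
  refine forall_congr' fun i => forall_congr' fun hi => ?_
  rw [h i (by omega), h (i+1) (by omega), h (i+2) (by omega)]

theorem endDesc_congr {len : ℕ} {w v : ℕ → ℕ} (h : ∀ i < len, w i = v i) :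
    EndDesc len w ↔ EndDesc len v := by
  unfold EndDesc
  refine and_congr_right fun hi => ?_
  rw [h _ (by omega : len - 1 < len), h _ (by omega : len - 2 < len)]

theorem endAsc_congr {len : ℕ} {w v : ℕ → ℕ} (h : ∀ i < len, w i = v i) :
    EndAsc len w ↔ EndAsc len v := by
  unfold EndAsc
  refine and_congr_right fun hi => ?_
  rw [h _ (by omega : len - 1 < len), h _ (by omega : len - 2 < len)]

theorem goodW_concat (k m : ℕ) (w : ℕ → ℕ) (hL : ∀ i < k, w i < w k)
    (hR : ∀ i < m, w (k + 1 + i) < w k) :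
    GoodW 0 (k + 1 + m) w ↔ GoodW 0 k w ∧ GoodW 1 m (fun i => w (k + 1 + i)) ∧
      (m = 0 → k % 2 = 1 → ¬ EndDesc k w) ∧ (0 < m → k % 2 = 0) := by
  constructor
  · intro h
    have hev : 0 < m → k % 2 = 0 := by
      intro hm
      by_contra hk
      obtain ⟨j, rfl⟩ : ∃ j, k = j + 1 := ⟨k - 1, by omega⟩
      have := (h j (by omega)).1 (by omega)
      exact this ⟨hL j (by omega), by simpa using hR 0 hm⟩
    refine ⟨fun i hi => h i (by omega), ?_, ?_, hev⟩
    · intro i hi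
      have hk := hev (by omega)
      have := h (k + 1 + i) (by omega)
      refine ⟨fun h1 => this.1 (by omega), fun h1 => this.2 (by omega)⟩
    · rintro rfl hk ⟨h2, h3⟩
      obtain ⟨j, rfl⟩ : ∃ j, k = j + 2 := ⟨k - 2, by omega⟩
      refine (h j (by omega)).2 (by omega) ⟨h3, hL (j+1) (by omega)⟩
  · rintro ⟨h1, h2, h3, h4⟩ i hi
    rcases lt_or_ge (i + 2) k with hk | hk
    · exact h1 i hk
    rcases hk.eq_or_lt with rfl | hk
    · have a := hL (i+1) (by omega)
      refine ⟨fun _ h => by omega, fun h5 h6 => ?_⟩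
      rcases Nat.eq_zero_or_pos m with hm | hm
      · exact h3 hm (by omega) ⟨by omega, h6.1⟩
      · have := h4 hm; omega
    rcases (by omega : k = i + 1 ∨ k ≤ i) with rfl | hk
    · have := h4 (by omega)
      refine ⟨fun h => by omega, fun _ h => ?_⟩
      have := hL i (by omega)
      omega
    have hke := h4 (by omega)
    rcases hk.eq_or_lt with rfl | hk
    · refine ⟨fun _ h => ?_, fun h => by omega⟩
      have := hR 0 (by omega)
      simp only [add_zero] at this
      omega
    · obtain ⟨j, rfl⟩ : ∃ j, i = k + 1 + j := ⟨i - (k+1), by omega⟩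
      have := h2 j (by omega)
      exact ⟨fun h => this.1 (by omega), fun h => this.2 (by omega)⟩

theorem endDesc_concat (k m : ℕ) (w : ℕ → ℕ) (hL : ∀ i < k, w i < w k)
    (hR : ∀ i < m, w (k + 1 + i) < w k) :
    ¬ EndDesc (k + 1 + m) w ↔ m = 0 ∨
      ((2 ≤ m) ∧ ¬ EndDesc m (fun i => w (k + 1 + i))) := by
  unfold EndDesc
  have hm : m = 0 ∨ m = 1 ∨ ∃ j, m = j + 2 := by
    rcases m with _ | _ | j
    · exact Or.inl rfl
    · exact Or.inr (Or.inl rfl)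
    · exact Or.inr (Or.inr ⟨j, rfl⟩)
  rcases hm with rfl | rfl | ⟨j, rfl⟩
  · simp only [true_or, iff_true]
    rintro ⟨h1, h2⟩
    have := hL (k - 1) (by omega)
    simp at h2
    omega
  · have := hR 0 (by omega)
    simp at this ⊢
    omega
  · simp [show k + 1 + (j + 2) - 1 = k + 1 + (j + 1) by omega,
      show k + 1 + (j + 2) - 2 = k + 1 + j by omega]
    omega

theorem permEnt_succ {n : ℕ} (σ : Equiv.Perm (Fin n)) (i : ℕ) (h : i < n) :
    permEnt σ (i + 1) = (σ ⟨i, h⟩ : ℕ) + 1 := by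
  unfold permEnt
  rw [dif_pos (by omega)]
  rfl

theorem goodPerm_iff {n : ℕ} (σ : Equiv.Perm (Fin n)) :
    GoodPerm σ ↔ GoodW 0 n (fun i => permEnt σ (i + 1)) := by
  constructor
  · intro h i hi
    refine ⟨fun h1 h2 => ?_, fun h1 h2 => ?_⟩
    · have := h.2 (i + 2) ⟨by omega, hi, h2⟩
      omega
    · have := h.1 (i + 2) ⟨by omega, hi, h2⟩
      omega
  · intro h
    refine ⟨fun i hi => ?_, fun i hi => ?_⟩
    · obtain ⟨h1, h2, h3⟩ := hi
      obtain ⟨j, rfl⟩ : ∃ j, i = j + 2 := ⟨i - 2, by omega⟩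
      by_contra hc
      exact (h j h2).2 (by omega) h3
    · obtain ⟨h1, h2, h3⟩ := hi
      obtain ⟨j, rfl⟩ : ∃ j, i = j + 2 := ⟨i - 2, by omega⟩
      by_contra hc
      exact (h j h2).1 (by omega) h3

theorem isDescent_iff {n : ℕ} (σ : Equiv.Perm (Fin n)) :
    IsDescent σ (n - 1) ↔ EndDesc n (fun i => permEnt σ (i + 1)) := by
  unfold IsDescent EndDesc
  constructor
  · rintro ⟨h1, h2, h3⟩
    exact ⟨by omega, by simpa [show n - 2 + 1 = n - 1 by omega] using h3⟩
  · rintro ⟨h1, h3⟩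
    exact ⟨by omega, by omega, by simpa [show n - 2 + 1 = n - 1 by omega] using h3⟩

/-- The word of a list. -/
def wd (l : List ℕ) (i : ℕ) : ℕ := l.getD i 0

theorem wd_ofFn {n : ℕ} (e : Fin n → ℕ) (i : ℕ) (h : i < n) :
    wd (List.ofFn e) i = e ⟨i, h⟩ := by
  unfold wd
  rw [List.getD_eq_getElem _ _ (by simpa using h)]
  simp

theorem good_ofFn_mono {n : ℕ} (e : Fin n → ℕ) (he : StrictMono e) (σ : Equiv.Perm (Fin n)) :
    GoodW 0 n (wd (List.ofFn (e ∘ σ))) ↔ GoodPerm σ := by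
  rw [goodPerm_iff]
  unfold GoodW
  refine forall_congr' fun i => forall_congr' fun hi => ?_
  simp only [wd_ofFn (e ∘ σ) i (by omega), wd_ofFn (e ∘ σ) (i+1) (by omega), wd_ofFn (e ∘ σ) (i+2) hi,
    permEnt_succ σ i (by omega), permEnt_succ σ (i+1) (by omega), permEnt_succ σ (i+2) hi,
    Function.comp, he.lt_iff_lt, Nat.add_lt_add_iff_right, Fin.lt_def]

theorem good_ofFn_anti {n : ℕ} (e : Fin n → ℕ) (he : StrictAnti e) (σ : Equiv.Perm (Fin n)) :
    GoodW 1 n (wd (List.ofFn (e ∘ σ))) ↔ GoodPerm σ := by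
  rw [goodPerm_iff]
  unfold GoodW
  refine forall_congr' fun i => forall_congr' fun hi => ?_
  simp only [wd_ofFn (e ∘ σ) i (by omega), wd_ofFn (e ∘ σ) (i+1) (by omega), wd_ofFn (e ∘ σ) (i+2) hi,
    permEnt_succ σ i (by omega), permEnt_succ σ (i+1) (by omega), permEnt_succ σ (i+2) hi,
    Function.comp, he.lt_iff_gt, Nat.add_lt_add_iff_right, Fin.lt_def]
  rw [and_comm]
  rw [show ((i + 1) % 2 = 1 ↔ (i + 0) % 2 = 0) by omega,
    show ((i + 1) % 2 = 0 ↔ (i + 0) % 2 = 1) by omega]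

theorem desc_ofFn_mono {n : ℕ} (e : Fin n → ℕ) (he : StrictMono e) (σ : Equiv.Perm (Fin n)) :
    EndDesc n (wd (List.ofFn (e ∘ σ))) ↔ IsDescent σ (n - 1) := by
  rw [isDescent_iff]
  unfold EndDesc
  refine and_congr_right fun hi => ?_
  simp only [wd_ofFn (e ∘ σ) (n-1) (by omega), wd_ofFn (e ∘ σ) (n-2) (by omega),
    permEnt_succ σ (n-1) (by omega), permEnt_succ σ (n-2) (by omega),
    Function.comp, he.lt_iff_lt, Nat.add_lt_add_iff_right, Fin.lt_def]

theorem asc_ofFn_anti {n : ℕ} (e : Fin n → ℕ) (he : StrictAnti e) (σ : Equiv.Perm (Fin n)) :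
    EndAsc n (wd (List.ofFn (e ∘ σ))) ↔ IsDescent σ (n - 1) := by
  rw [isDescent_iff]
  unfold EndDesc EndAsc
  refine and_congr_right fun hi => ?_
  simp only [wd_ofFn (e ∘ σ) (n-1) (by omega), wd_ofFn (e ∘ σ) (n-2) (by omega),
    permEnt_succ σ (n-1) (by omega), permEnt_succ σ (n-2) (by omega),
    Function.comp, he.lt_iff_gt, Nat.add_lt_add_iff_right, Fin.lt_def]

/-- The arrangements of `S`. -/
def arr (S : Finset ℕ) : Finset (List ℕ) := S.val.lists.toFinset

open Classical in
/-- Number of arrangements of `S` satisfying `Q`. -/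
noncomputable def cnt (S : Finset ℕ) (Q : List ℕ → Prop) : ℕ :=
  ((arr S).filter Q).card

theorem mem_lists' {S : Finset ℕ} {l : List ℕ} :
    l ∈ arr S ↔ l.Nodup ∧ l.toFinset = S := by
  unfold arr
  rw [Multiset.mem_toFinset, Multiset.mem_lists_iff]
  constructor
  · intro h
    have hn : l.Nodup := by
      have := S.nodup
      rw [h] at this
      exact this
    refine ⟨hn, ?_⟩
    ext a
    rw [List.mem_toFinset, ← Finset.mem_val, h]
    rfl
  · rintro ⟨h1, rfl⟩
    rw [List.toFinset_val, h1.dedup]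
    rfl

theorem cnt_eq {n : ℕ} (S : Finset ℕ) (e : Fin n → ℕ) (he : Function.Injective e)
    (hS : Finset.univ.image e = S) (Q : List ℕ → Prop) :
    cnt S Q = Nat.card {σ : Equiv.Perm (Fin n) // Q (List.ofFn (e ∘ σ))} := by
  classical
  rw [Nat.card_eq_fintype_card, Fintype.card_subtype]
  unfold cnt
  symm
  refine Finset.card_bij (fun σ _ => List.ofFn (e ∘ σ)) ?_ ?_ ?_
  · intro σ hσ
    simp only [Finset.mem_filter, Finset.mem_univ, true_and] at hσ
    rw [Finset.mem_filter, mem_lists']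
    refine ⟨⟨List.nodup_ofFn.2 (he.comp σ.injective), ?_⟩, hσ⟩
    rw [← hS]
    ext a
    simp only [List.mem_toFinset, List.mem_ofFn, Finset.mem_image, Finset.mem_univ, true_and,
      Function.comp]
    constructor
    · rintro ⟨i, rfl⟩; exact ⟨_, rfl⟩
    · rintro ⟨i, rfl⟩; exact ⟨σ.symm i, by simp⟩
  · intro σ _ τ _ h
    have := List.ofFn_injective h
    ext i
    exact congrArg Fin.val (he (congrFun this i))
  · intro l hl
    rw [Finset.mem_filter, mem_lists'] at hl
    obtain ⟨⟨hn, hl⟩, hQ⟩ := hl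
    have hlen : l.length = n := by
      rw [← List.toFinset_card_of_nodup hn, hl, ← hS, Finset.card_image_of_injective _ he]
      simp
    subst hlen
    have : ∀ i : Fin l.length, ∃ j, e j = l.get i := by
      intro i
      have : l.get i ∈ S := by rw [← hl]; simp
      rw [← hS] at this
      simpa using this
    choose τ hτ using this
    have hinj : Function.Injective τ := by
      intro i j hij
      apply List.nodup_iff_injective_get.1 hn
      rw [← hτ, ← hτ, hij]
    let σ := Equiv.ofBijective τ (Finite.injective_iff_bijective.1 hinj)
    have hσ : List.ofFn (e ∘ σ) = l := by
      have : e ∘ σ = l.get := funext hτ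
      rw [this, List.ofFn_get]
    refine ⟨σ, ?_, hσ⟩
    simp only [Finset.mem_filter, Finset.mem_univ, true_and]
    rwa [hσ]

/-- number of good permutations ending in a descent -/
noncomputable def hCount (n : ℕ) : ℕ :=
  Nat.card {σ : Equiv.Perm (Fin n) // GoodPerm σ ∧ IsDescent σ (n - 1)}

theorem f_eq_g_add_h (n : ℕ) : fCount n = gCount n + hCount n := by
  classical
  unfold fCount gCount hCount
  simp only [Nat.card_eq_fintype_card, Fintype.card_subtype]
  rw [← Finset.filter_filter, ← Finset.filter_filter, add_comm,
    Finset.card_filter_add_card_filter_not]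

theorem exists_mono (S : Finset ℕ) : ∃ e : Fin S.card → ℕ, StrictMono e ∧
    Finset.univ.image e = S :=
  ⟨S.orderEmbOfFin rfl, (S.orderEmbOfFin rfl).strictMono, by simp⟩

theorem exists_anti (S : Finset ℕ) : ∃ e : Fin S.card → ℕ, StrictAnti e ∧
    Finset.univ.image e = S := by
  refine ⟨S.orderEmbOfFin rfl ∘ Fin.rev, (S.orderEmbOfFin rfl).strictMono.comp_strictAnti
    Fin.rev_strictAnti, ?_⟩
  rw [← Finset.image_image, Finset.image_univ_of_surjective Fin.rev_surjective]
  simp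

theorem cnt_f (S : Finset ℕ) :
    cnt S (fun l => GoodW 0 l.length (wd l)) = fCount S.card := by
  obtain ⟨e, he, hS⟩ := exists_mono S
  rw [cnt_eq S e he.injective hS]
  simp only [List.length_ofFn, good_ofFn_mono e he]
  rfl

theorem cnt_g (S : Finset ℕ) :
    cnt S (fun l => GoodW 0 l.length (wd l) ∧ ¬ EndDesc l.length (wd l)) = gCount S.card := by
  obtain ⟨e, he, hS⟩ := exists_mono S
  rw [cnt_eq S e he.injective hS]
  simp only [List.length_ofFn, good_ofFn_mono e he, desc_ofFn_mono e he]
  rfl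

theorem cnt_f' (S : Finset ℕ) :
    cnt S (fun l => GoodW 1 l.length (wd l)) = fCount S.card := by
  obtain ⟨e, he, hS⟩ := exists_anti S
  rw [cnt_eq S e he.injective hS]
  simp only [List.length_ofFn, good_ofFn_anti e he]
  rfl

theorem cnt_h' (S : Finset ℕ) :
    cnt S (fun l => GoodW 1 l.length (wd l) ∧ EndAsc l.length (wd l)) = hCount S.card := by
  obtain ⟨e, he, hS⟩ := exists_anti S
  rw [cnt_eq S e he.injective hS]
  simp only [List.length_ofFn, good_ofFn_anti e he, asc_ofFn_anti e he]
  rfl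

theorem cnt_false (S : Finset ℕ) : cnt S (fun _ => False) = 0 := by
  simp [cnt]

theorem cnt_decomp (S : Finset ℕ) (M : ℕ) (hM : M ∉ S) (Q : List ℕ → Prop)
    (Q1 Q2 : Finset ℕ → List ℕ → Prop)
    (h : ∀ T ⊆ S, ∀ L ∈ arr T, ∀ R ∈ arr (S \ T),
      (Q (L ++ M :: R) ↔ Q1 T L ∧ Q2 T R)) :
    cnt (insert M S) Q = ∑ T ∈ S.powerset, cnt T (Q1 T) * cnt (S \ T) (Q2 T) := by
  classical
  unfold cnt
  rw [Finset.card_eq_sum_card_fiberwise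
    (f := fun l : List ℕ => (l.takeWhile (fun x => x ≠ M)).toFinset) (t := S.powerset)]
  · refine Finset.sum_congr rfl fun T hT => ?_
    rw [Finset.mem_powerset] at hT
    rw [← Finset.card_product]
    symm
    have tw : ∀ L R : List ℕ, M ∉ L → (L ++ M :: R).takeWhile (fun x => x ≠ M) = L := by
      intro L R hL
      rw [List.takeWhile_append_of_pos]
      · simp
      · intro a ha
        simp only [decide_eq_true_eq]
        rintro rfl
        exact hL ha
    refine Finset.card_bij (fun P _ => P.1 ++ M :: P.2) ?_ ?_ ?_
    · rintro ⟨L, R⟩ hLR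
      simp only [Finset.mem_product, Finset.mem_filter] at hLR
      obtain ⟨⟨hL, hQ1⟩, hR, hQ2⟩ := hLR
      have hQ := (h T hT L hL R hR).2 ⟨hQ1, hQ2⟩
      rw [mem_lists'] at hL hR
      obtain ⟨hLn, rfl⟩ := hL
      obtain ⟨hRn, hR⟩ := hR
      have hML : M ∉ L := fun hx => hM (hT (by simpa using hx))
      have hMR : M ∉ R := fun hx => hM (Finset.sdiff_subset (by rw [← hR]; simpa using hx))
      simp only [Finset.mem_filter, mem_lists']
      refine ⟨⟨⟨?_, ?_⟩, hQ⟩, ?_⟩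
      · rw [List.nodup_append]
        refine ⟨hLn, List.nodup_cons.2 ⟨hMR, hRn⟩, ?_⟩
        intro a ha b hb hab
        subst hab
        rcases List.mem_cons.1 hb with rfl | hb
        · exact hML ha
        · have : a ∈ R.toFinset := by simpa using hb
          rw [hR] at this
          simp [ha] at this
      · rw [List.toFinset_append, List.toFinset_cons, hR]
        ext a
        have := @hT a
        simp only [Finset.mem_union, Finset.mem_insert, Finset.mem_sdiff]
        tauto
      · rw [tw _ _ hML]
    · rintro ⟨L, R⟩ hLR ⟨L', R'⟩ hLR' heq
      simp only [Finset.mem_product, Finset.mem_filter, mem_lists'] at hLR hLR'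
      have hML : M ∉ L := fun hx => hM (hT (by rw [← hLR.1.1.2]; simpa using hx))
      have hML' : M ∉ L' := fun hx => hM (hT (by rw [← hLR'.1.1.2]; simpa using hx))
      have e1 : L = L' := by rw [← tw L R hML, heq, tw L' R' hML']
      subst e1
      simpa using heq
    · intro l hl
      simp only [Finset.mem_filter, mem_lists'] at hl
      obtain ⟨⟨⟨hn, hl⟩, hQ⟩, hT2⟩ := hl
      have hMl : M ∈ l := by rw [← List.mem_toFinset, hl]; simp
      obtain ⟨L, R, rfl⟩ := List.append_of_mem hMl
      have hn' := hn
      rw [List.nodup_append] at hn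
      obtain ⟨hLn, hRn, hd⟩ := hn
      have hML : M ∉ L := fun hx => hd M hx M (by simp) rfl
      rw [tw _ _ hML] at hT2
      rw [List.nodup_cons] at hRn
      have hL : L ∈ arr T := mem_lists'.2 ⟨hLn, hT2⟩
      have hR : R ∈ arr (S \ T) := by
        refine mem_lists'.2 ⟨hRn.2, ?_⟩
        ext a
        have h1 : a ∈ (L ++ M :: R).toFinset ↔ a ∈ insert M S := by rw [hl]
        simp only [List.mem_toFinset, List.mem_append, List.mem_cons, Finset.mem_insert] at h1
        rw [Finset.mem_sdiff, ← hT2]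
        simp only [List.mem_toFinset]
        have h2 : a ∈ R → a ≠ M := by rintro h3 rfl; exact hRn.1 h3
        have h3 : a ∈ R → a ∉ L := fun h3 h4 => hd a h4 a (by simp [h3]) rfl
        have h4 : a ∈ S → a ≠ M := by rintro h3 rfl; exact hM h3
        tauto
      have := (h T hT L hL R hR).1 hQ
      refine ⟨(L, R), ?_, rfl⟩
      simp only [Finset.mem_product, Finset.mem_filter]
      exact ⟨⟨hL, this.1⟩, hR, this.2⟩
  · intro l hl
    simp only [Finset.coe_filter, Set.mem_setOf_eq, mem_lists'] at hl
    simp only [Finset.coe_powerset, Set.mem_preimage, Set.mem_powerset_iff]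
    intro a ha
    simp only [Finset.mem_coe, List.mem_toFinset] at ha ⊢
    have h1 := List.mem_takeWhile_imp ha
    have h2 : a ∈ l := (List.takeWhile_prefix _).subset ha
    rw [← List.mem_toFinset, hl.1.2] at h2
    simp only [decide_eq_true_eq] at h1
    exact (Finset.mem_insert.1 h2).resolve_left h1

theorem wd_left (L R : List ℕ) (M i : ℕ) (h : i < L.length) : wd (L ++ M :: R) i = wd L i := by
  unfold wd
  rw [List.getD_append _ _ _ _ h]

theorem wd_mid (L R : List ℕ) (M : ℕ) : wd (L ++ M :: R) L.length = M := by
  unfold wd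
  rw [List.getD_append_right _ _ _ _ le_rfl]
  simp

theorem wd_right (L R : List ℕ) (M i : ℕ) : wd (L ++ M :: R) (L.length + 1 + i) = wd R i := by
  unfold wd
  rw [List.getD_append_right _ _ _ _ (by omega)]
  rw [show L.length + 1 + i - L.length = i + 1 by omega]
  simp

theorem wd_mem (L : List ℕ) (i : ℕ) (h : i < L.length) : wd L i ∈ L := by
  unfold wd
  rw [List.getD_eq_getElem _ _ h]
  simp

theorem good_list (L R : List ℕ) (M : ℕ) (hL : ∀ x ∈ L, x < M) (hR : ∀ x ∈ R, x < M) :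
    GoodW 0 (L ++ M :: R).length (wd (L ++ M :: R)) ↔
      GoodW 0 L.length (wd L) ∧ GoodW 1 R.length (wd R) ∧
      (R.length = 0 → L.length % 2 = 1 → ¬ EndDesc L.length (wd L)) ∧
      (0 < R.length → L.length % 2 = 0) := by
  have e : (L ++ M :: R).length = L.length + 1 + R.length := by simp; omega
  rw [e, goodW_concat]
  · rw [goodW_congr (fun i hi => wd_left L R M i hi), endDesc_congr (fun i hi => wd_left L R M i hi)]
    simp only [wd_right]
  · intro i hi
    rw [wd_mid, wd_left _ _ _ _ hi]
    exact hL _ (wd_mem _ _ hi)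
  · intro i hi
    rw [wd_mid, wd_right]
    exact hR _ (wd_mem _ _ hi)

theorem desc_list (L R : List ℕ) (M : ℕ) (hL : ∀ x ∈ L, x < M) (hR : ∀ x ∈ R, x < M)
    (hRn : R.Nodup) :
    ¬ EndDesc (L ++ M :: R).length (wd (L ++ M :: R)) ↔
      R.length = 0 ∨ EndAsc R.length (wd R) := by
  have e : (L ++ M :: R).length = L.length + 1 + R.length := by simp; omega
  rw [e, endDesc_concat]
  · simp only [wd_right]
    unfold EndDesc EndAsc
    refine or_congr Iff.rfl (and_congr_right fun h2 => ?_)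
    have : wd R (R.length - 1) ≠ wd R (R.length - 2) := by
      unfold wd
      rw [List.getD_eq_getElem _ _ (by omega), List.getD_eq_getElem _ _ (by omega)]
      intro h
      have := (hRn.getElem_inj_iff).1 h
      omega
    show ¬ (2 ≤ R.length ∧ wd R (R.length - 1) < wd R (R.length - 2)) ↔ _
    omega
  · intro i hi
    rw [wd_mid, wd_left _ _ _ _ hi]
    exact hL _ (wd_mem _ _ hi)
  · intro i hi
    rw [wd_mid, wd_right]
    exact hR _ (wd_mem _ _ hi)

theorem length_lists {S : Finset ℕ} {l : List ℕ} (h : l ∈ arr S) : l.length = S.card := by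
  rw [mem_lists'] at h
  rw [← h.2, List.toFinset_card_of_nodup h.1]

theorem lt_of_lists {n : ℕ} {S : Finset ℕ} {l : List ℕ} (h : l ∈ arr S)
    (hS : S ⊆ Finset.range n) : ∀ x ∈ l, x < n := by
  intro x hx
  rw [mem_lists'] at h
  have : x ∈ l.toFinset := by simpa using hx
  rw [h.2] at this
  simpa using hS this

theorem gCount_le (n : ℕ) : gCount n ≤ fCount n := by rw [f_eq_g_add_h]; omega

theorem fCount_le (n : ℕ) : fCount n ≤ n.factorial := by
  classical
  unfold fCount
  rw [Nat.card_eq_fintype_card]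
  refine (Fintype.card_subtype_le _).trans ?_
  rw [Fintype.card_perm, Fintype.card_fin]

theorem fCount_zero : fCount 0 = 1 := by
  have : ∀ σ : Equiv.Perm (Fin 0), GoodPerm σ := fun σ =>
    ⟨fun i hi => by have := hi.2.1; omega, fun i hi => by have := hi.2.1; omega⟩
  unfold fCount
  simp [this]

theorem hCount_zero : hCount 0 = 0 := by
  have : ∀ σ : Equiv.Perm (Fin 0), ¬ IsDescent σ 0 := fun σ hi => by have := hi.1; omega
  unfold hCount
  simp [this]

theorem gCount_zero : gCount 0 = 1 := by
  have := f_eq_g_add_h 0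
  rw [fCount_zero, hCount_zero] at this
  omega

theorem f_rec (n : ℕ) : fCount (n + 1) =
    (∑ k ∈ Finset.range (n + 1), n.choose k *
      ((if k % 2 = 0 then fCount k else 0) * fCount (n - k))) +
      (if n % 2 = 1 then gCount n else 0) := by
  have h1 : fCount (n+1) = cnt (insert n (Finset.range n))
      (fun l => GoodW 0 l.length (wd l)) := by
    rw [cnt_f]; simp
  rw [h1, cnt_decomp (Finset.range n) n (by simp) _
    (fun T l => GoodW 0 l.length (wd l) ∧
      ((n - T.card = 0 → T.card % 2 = 1 → ¬ EndDesc l.length (wd l)) ∧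
      (0 < n - T.card → T.card % 2 = 0)))
    (fun T l => GoodW 1 l.length (wd l))]
  · have key : ∀ T ∈ (Finset.range n).powerset, cnt T (fun l => GoodW 0 l.length (wd l) ∧
        ((n - T.card = 0 → T.card % 2 = 1 → ¬ EndDesc l.length (wd l)) ∧
        (0 < n - T.card → T.card % 2 = 0))) *
        cnt (Finset.range n \ T) (fun l => GoodW 1 l.length (wd l)) =
        (fun k => (if k % 2 = 0 then fCount k else 0) * fCount (n - k) +
          (if k = n then if n % 2 = 1 then gCount n else 0 else 0)) T.card := by
      intro T hT
      rw [Finset.mem_powerset] at hT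
      have hc := Finset.card_le_card hT
      rw [Finset.card_range] at hc
      rw [cnt_f', Finset.card_sdiff_of_subset hT, Finset.card_range]
      rcases Nat.mod_two_eq_zero_or_one T.card with h0 | h0
      · have : ¬ (T.card = n ∧ n % 2 = 1) := by omega
        simp only [h0, zero_ne_one, false_imp_iff, imp_true_iff, and_true, if_true, cnt_f]
        rw [← ite_and, if_neg this, add_zero]
      · rcases hc.eq_or_lt with h2 | h2
        · rw [h2] at h0
          simp [h0, h2, cnt_g, fCount_zero]
        · have h3 : 0 < n - T.card := by omega
          simp [h0, h3, h2.ne, cnt_false]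
    rw [Finset.sum_congr rfl key, Finset.sum_powerset_apply_card (fun k => (if k % 2 = 0 then fCount k else 0) * fCount (n - k) +
          (if k = n then if n % 2 = 1 then gCount n else 0 else 0)), Finset.card_range]
    simp only [smul_eq_mul, mul_add, Finset.sum_add_distrib]
    congr 1
    simp
  · intro T hT L hL R hR
    rw [good_list L R n (lt_of_lists hL hT) (lt_of_lists hR Finset.sdiff_subset),
      length_lists hL, length_lists hR, Finset.card_sdiff_of_subset hT, Finset.card_range]
    tauto

theorem g_rec (n : ℕ) : gCount (n + 1) =
    (∑ k ∈ Finset.range (n + 1), n.choose k *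
      ((if k % 2 = 0 then fCount k else 0) * hCount (n - k))) +
      (if n % 2 = 1 then gCount n else fCount n) := by
  have h1 : gCount (n+1) = cnt (insert n (Finset.range n))
      (fun l => GoodW 0 l.length (wd l) ∧ ¬ EndDesc l.length (wd l)) := by
    rw [cnt_g]; simp
  rw [h1, cnt_decomp (Finset.range n) n (by simp) _
    (fun T l => GoodW 0 l.length (wd l) ∧
      ((n - T.card = 0 → T.card % 2 = 1 → ¬ EndDesc l.length (wd l)) ∧
      (0 < n - T.card → T.card % 2 = 0)))
    (fun T l => GoodW 1 l.length (wd l) ∧ (n - T.card = 0 ∨ EndAsc l.length (wd l)))]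
  · have key : ∀ T ∈ (Finset.range n).powerset, cnt T (fun l => GoodW 0 l.length (wd l) ∧
        ((n - T.card = 0 → T.card % 2 = 1 → ¬ EndDesc l.length (wd l)) ∧
        (0 < n - T.card → T.card % 2 = 0))) *
        cnt (Finset.range n \ T) (fun l => GoodW 1 l.length (wd l) ∧
          (n - T.card = 0 ∨ EndAsc l.length (wd l))) =
        (fun k => (if k % 2 = 0 then fCount k else 0) * hCount (n - k) +
          (if k = n then if n % 2 = 1 then gCount n else fCount n else 0)) T.card := by
      intro T hT
      rw [Finset.mem_powerset] at hT
      have hc := Finset.card_le_card hT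
      rw [Finset.card_range] at hc
      have hd := Finset.card_sdiff_of_subset hT
      rw [Finset.card_range] at hd
      rcases hc.eq_or_lt with h2 | h2
      · have h3 : n - T.card = 0 := by omega
        have h5 : cnt (Finset.range n \ T) (fun l => GoodW 1 l.length (wd l)) = 1 := by
          rw [cnt_f', hd, h3, fCount_zero]
        rw [h3] at hd
        simp only [h3, true_or, and_true, cnt_f', hd, hCount_zero, mul_zero, zero_add, h2, if_true,
          fCount_zero, mul_one, lt_irrefl, false_imp_iff, true_imp_iff]
        rcases Nat.mod_two_eq_zero_or_one n with h0 | h0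
        · simp [h0, cnt_f, h2, h5, hCount_zero]
        · simp [h0, cnt_g, h2, h5, hCount_zero]
      · have h3 : 0 < n - T.card := by omega
        have h4 : n - T.card ≠ 0 := by omega
        simp only [h4, h3, h2.ne, false_or, false_imp_iff, true_imp_iff, true_and, if_false,
          add_zero, cnt_h', hd]
        rcases Nat.mod_two_eq_zero_or_one T.card with h0 | h0
        · simp [h0, cnt_f]
        · simp [h0, cnt_false]
    rw [Finset.sum_congr rfl key, Finset.sum_powerset_apply_card (fun k => (if k % 2 = 0 then fCount k else 0) * hCount (n - k) +
          (if k = n then if n % 2 = 1 then gCount n else fCount n else 0)), Finset.card_range]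
    simp only [smul_eq_mul, mul_add, Finset.sum_add_distrib]
    congr 1
    simp
  · intro T hT L hL R hR
    rw [good_list L R n (lt_of_lists hL hT) (lt_of_lists hR Finset.sdiff_subset),
      desc_list L R n (lt_of_lists hL hT) (lt_of_lists hR Finset.sdiff_subset)
        (mem_lists'.1 hR).1,
      length_lists hL, length_lists hR, Finset.card_sdiff_of_subset hT, Finset.card_range]
    tauto

/-- exponential generating function -/
noncomputable def egf (a : ℕ → ℝ) (x : ℝ) : ℝ := ∑' n : ℕ, a n * x ^ n / n.factorial

/-- binomial convolution -/
noncomputable def bconv (a b : ℕ → ℝ) (n : ℕ) : ℝ :=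
  ∑ k ∈ Finset.range (n + 1), (n.choose k : ℝ) * (a k * b (n - k))

theorem egf_summ {a : ℕ → ℝ} (ha : ∀ n, |a n| ≤ n.factorial) {x : ℝ} (hx : |x| < 1) :
    Summable (fun n : ℕ => ‖a n * x ^ n / n.factorial‖) := by
  refine Summable.of_nonneg_of_le (fun n => norm_nonneg _) (fun n => ?_)
    (summable_geometric_of_lt_one (abs_nonneg x) hx)
  have hp : (0 : ℝ) < n.factorial := by exact_mod_cast n.factorial_pos
  rw [norm_div, norm_mul, norm_pow, Real.norm_eq_abs, Real.norm_eq_abs, Real.norm_eq_abs,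
    abs_of_pos hp, div_le_iff₀ hp, mul_comm]
  exact mul_le_mul_of_nonneg_left (ha n) (by positivity)

theorem egf_deriv {a : ℕ → ℝ} (ha : ∀ n, |a n| ≤ n.factorial) {x : ℝ} (hx : |x| < 1) :
    HasDerivAt (egf a) (egf (fun n => a (n + 1)) x) x := by
  obtain ⟨r, hr, hr1⟩ := exists_between hx
  have hr0 : 0 ≤ r := (abs_nonneg x).trans hr.le
  have hu : Summable (fun n : ℕ => (n : ℝ) * r ^ (n - 1)) := by
    rw [← summable_nat_add_iff 1]
    have h1 := summable_pow_mul_geometric_of_norm_lt_one 1 (r := r)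
      (by rwa [Real.norm_eq_abs, abs_of_nonneg hr0])
    have h2 := summable_geometric_of_lt_one hr0 hr1
    refine (h1.add h2).congr fun n => ?_
    push_cast
    simp
    ring
  have key := hasDerivAt_tsum_of_isPreconnected (𝕜 := ℝ) (u := fun n : ℕ => (n : ℝ) * r ^ (n - 1))
    (g := fun (n : ℕ) (y : ℝ) => a n * y ^ n / n.factorial)
    (g' := fun (n : ℕ) (y : ℝ) => a n * (n * y ^ (n - 1)) / n.factorial)
    (t := Metric.ball 0 r) (y₀ := x) (y := x) hu Metric.isOpen_ball
    (convex_ball (0:ℝ) r).isPreconnected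
    (fun n y _ => ((hasDerivAt_pow n y).const_mul (a n)).div_const _)
    (fun n y hy => by
      have hp : (0 : ℝ) < n.factorial := by exact_mod_cast n.factorial_pos
      have hy' : |y| ≤ r := by
        have := Metric.mem_ball.1 hy
        rw [Real.dist_eq, sub_zero] at this
        exact this.le
      rw [norm_div, norm_mul, norm_mul, norm_pow, Real.norm_eq_abs, Real.norm_eq_abs,
        Real.norm_eq_abs, Real.norm_eq_abs, abs_of_pos hp, div_le_iff₀ hp, mul_comm,
        abs_of_nonneg (Nat.cast_nonneg n)]
      have := ha n
      gcongr)
    (by rwa [Metric.mem_ball, Real.dist_eq, sub_zero])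
    (egf_summ ha hx).of_norm
    (by rwa [Metric.mem_ball, Real.dist_eq, sub_zero])
  have e : ∑' n : ℕ, a n * (n * x ^ (n - 1)) / n.factorial = egf (fun n => a (n + 1)) x := by
    have hs : Summable (fun n : ℕ => a n * (n * x ^ (n - 1)) / n.factorial) := by
      refine Summable.of_norm_bounded hu fun n => ?_
      have hp : (0 : ℝ) < n.factorial := by exact_mod_cast n.factorial_pos
      rw [norm_div, norm_mul, norm_mul, norm_pow, Real.norm_eq_abs, Real.norm_eq_abs,
        Real.norm_eq_abs, Real.norm_eq_abs, abs_of_pos hp, div_le_iff₀ hp, mul_comm,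
        abs_of_nonneg (Nat.cast_nonneg n)]
      have := ha n
      gcongr
    rw [hs.tsum_eq_zero_add]
    simp only [Nat.cast_zero, zero_mul, mul_zero, zero_div, zero_add]
    unfold egf
    refine tsum_congr fun n => ?_
    have hp : (n.factorial : ℝ) ≠ 0 := by exact_mod_cast n.factorial_ne_zero
    have hq : ((n : ℝ) + 1) ≠ 0 := by positivity
    rw [Nat.factorial_succ]
    push_cast
    try rw [Nat.add_sub_cancel]
    field_simp
  rw [e] at key
  exact key

theorem bconv_term (a b : ℕ → ℝ) (x : ℝ) (n : ℕ) :
    ∑ k ∈ Finset.range (n + 1), (a k * x ^ k / k.factorial) *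
      (b (n - k) * x ^ (n - k) / (n - k).factorial) = bconv a b n * x ^ n / n.factorial := by
  unfold bconv
  rw [Finset.sum_mul, Finset.sum_div]
  refine Finset.sum_congr rfl fun k hk => ?_
  have hk' : k ≤ n := by rw [Finset.mem_range] at hk; omega
  have h1 : (k.factorial : ℝ) ≠ 0 := by exact_mod_cast k.factorial_ne_zero
  have h2 : ((n - k).factorial : ℝ) ≠ 0 := by exact_mod_cast (n - k).factorial_ne_zero
  have h3 : (n.factorial : ℝ) ≠ 0 := by exact_mod_cast n.factorial_ne_zero
  rw [Nat.cast_choose ℝ hk']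
  have hxp : x ^ n = x ^ k * x ^ (n - k) := by rw [← pow_add]; congr 1; omega
  rw [hxp]
  field_simp

theorem egf_ode {a b c d : ℕ → ℝ} (ha : ∀ n, |a n| ≤ n.factorial) (hb : ∀ n, |b n| ≤ n.factorial)
    (hc : ∀ n, |c n| ≤ n.factorial) (hd : ∀ n, |d n| ≤ n.factorial)
    (hrec : ∀ n, a (n + 1) = bconv b c n + d n) {x : ℝ} (hx : |x| < 1) :
    HasDerivAt (egf a) (egf b x * egf c x + egf d x) x := by
  have h := egf_deriv ha hx
  have e : egf (fun n => a (n + 1)) x = egf b x * egf c x + egf d x := by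
    have sb := egf_summ hb hx
    have sc := egf_summ hc hx
    have sd := (egf_summ hd hx).of_norm
    have hs := (summable_norm_sum_mul_range_of_summable_norm sb sc).of_norm
    have hm := tsum_mul_tsum_eq_tsum_sum_range_of_summable_norm sb sc
    simp only [bconv_term] at hs hm
    unfold egf
    rw [hm, ← hs.tsum_add sd]
    refine tsum_congr fun n => ?_
    simp only [hrec]
    ring
  rwa [e] at h

theorem egf_sub {a b : ℕ → ℝ} (ha : ∀ n, |a n| ≤ n.factorial) (hb : ∀ n, |b n| ≤ n.factorial)
    {x : ℝ} (hx : |x| < 1) : egf (fun n => a n - b n) x = egf a x - egf b x := by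
  unfold egf
  rw [← (egf_summ ha hx).of_norm.tsum_sub (egf_summ hb hx).of_norm]
  refine tsum_congr fun n => ?_
  ring

theorem egf_zero (a : ℕ → ℝ) : egf a 0 = a 0 := by
  unfold egf
  rw [tsum_eq_single 0]
  · simp
  · intro n hn
    simp [hn]

/-- restriction of a counting sequence to a parity class -/
noncomputable def par (p : ℕ) (u : ℕ → ℕ) (n : ℕ) : ℝ := if n % 2 = p then (u n : ℝ) else 0

theorem par_bound (p : ℕ) {u : ℕ → ℕ} (hu : ∀ n, u n ≤ n.factorial) (n : ℕ) :
    |par p u n| ≤ n.factorial := by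
  unfold par
  split_ifs
  · rw [abs_of_nonneg (Nat.cast_nonneg _)]
    exact_mod_cast hu n
  · simp

theorem bconv_par (q : ℕ) (hq : q < 2) (u v : ℕ → ℕ) (n : ℕ) :
    bconv (par 0 u) (par q v) n = if n % 2 = q then
      ((∑ k ∈ Finset.range (n + 1), n.choose k *
        ((if k % 2 = 0 then u k else 0) * v (n - k)) : ℕ) : ℝ) else 0 := by
  unfold bconv par
  split_ifs with h
  · push_cast
    refine Finset.sum_congr rfl fun k hk => ?_
    rw [Finset.mem_range] at hk
    by_cases hk2 : k % 2 = 0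
    · rw [if_pos hk2, if_pos (by omega)]
    · rw [if_neg hk2, zero_mul, zero_mul]
  · refine Finset.sum_eq_zero fun k hk => ?_
    rw [Finset.mem_range] at hk
    by_cases hk2 : k % 2 = 0
    · rw [if_neg (by omega : ¬ (n - k) % 2 = q)]; simp
    · rw [if_neg hk2]; simp

theorem rec_f1 (n : ℕ) : par 1 fCount (n + 1) = bconv (par 0 fCount) (par 0 fCount) n + 0 := by
  rw [bconv_par 0 (by omega)]
  rcases Nat.mod_two_eq_zero_or_one n with h | h
  · rw [par, if_pos (by omega), if_pos h, f_rec, if_neg (by omega)]; simp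
  · rw [par, if_neg (by omega), if_neg (by omega)]; simp

theorem rec_f2 (n : ℕ) : par 0 fCount (n + 1) =
    bconv (par 0 fCount) (par 1 fCount) n + par 1 gCount n := by
  rw [bconv_par 1 (by omega)]
  rcases Nat.mod_two_eq_zero_or_one n with h | h
  · rw [par, par, if_neg (by omega), if_neg (by omega), if_neg (by omega)]; simp
  · rw [par, par, if_pos (by omega), if_pos h, f_rec, if_pos h, if_pos h, Nat.cast_add]

theorem rec_g1 (n : ℕ) : par 1 gCount (n + 1) =
    bconv (par 0 fCount) (par 0 hCount) n + par 0 fCount n := by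
  rw [bconv_par 0 (by omega)]
  rcases Nat.mod_two_eq_zero_or_one n with h | h
  · rw [par, par, if_pos (by omega), if_pos h, g_rec, if_neg (by omega), if_pos h, Nat.cast_add]
  · rw [par, par, if_neg (by omega), if_neg (by omega), if_neg (by omega)]; simp

theorem rec_g2 (n : ℕ) : par 0 gCount (n + 1) =
    bconv (par 0 fCount) (par 1 hCount) n + par 1 gCount n := by
  rw [bconv_par 1 (by omega)]
  rcases Nat.mod_two_eq_zero_or_one n with h | h
  · rw [par, par, if_neg (by omega), if_neg (by omega), if_neg (by omega)]; simp
  · rw [par, par, if_pos (by omega), if_pos h, g_rec, if_pos h, if_pos h, Nat.cast_add]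

theorem par_h (p : ℕ) : par p hCount = fun n => par p fCount n - par p gCount n := by
  funext n
  unfold par
  rw [f_eq_g_add_h]
  split_ifs <;> simp

theorem F1_eq : F1 = egf (par 1 fCount) := rfl
theorem F2_eq : F2 = egf (par 0 fCount) := rfl
theorem G1_eq : G1 = egf (par 1 gCount) := rfl
theorem G2_eq : G2 = egf (par 0 gCount) := rfl

/-- the system of differential equations satisfied by `F₁, F₂, G₁, G₂`
on `(−1, 1)`, together with the convergence of the series and the initial conditions. -/
theorem statement4 :
    (∀ x : ℝ, |x| < 1 →
      (Summable (fun n : ℕ => (if n % 2 = 1 then (fCount n : ℝ) else 0) * x ^ n / n.factorial) ∧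
       Summable (fun n : ℕ => (if n % 2 = 0 then (fCount n : ℝ) else 0) * x ^ n / n.factorial) ∧
       Summable (fun n : ℕ => (if n % 2 = 1 then (gCount n : ℝ) else 0) * x ^ n / n.factorial) ∧
       Summable (fun n : ℕ => (if n % 2 = 0 then (gCount n : ℝ) else 0) * x ^ n / n.factorial)) ∧
      HasDerivAt F1 (F2 x ^ 2) x ∧
      HasDerivAt F2 (F1 x * F2 x + G1 x) x ∧
      HasDerivAt G1 (F2 x * (F2 x - G2 x) + F2 x) x ∧
      HasDerivAt G2 (F2 x * (F1 x - G1 x) + G1 x) x) ∧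
    F1 0 = 0 ∧ G1 0 = 0 ∧ F2 0 = 1 ∧ G2 0 = 1 := by
  have bf : ∀ n, fCount n ≤ n.factorial := fCount_le
  have bg : ∀ n, gCount n ≤ n.factorial := fun n => (gCount_le n).trans (bf n)
  have bh : ∀ n, hCount n ≤ n.factorial := fun n => by
    have := f_eq_g_add_h n
    have := bf n
    omega
  refine ⟨fun x hx => ⟨⟨?_, ?_, ?_, ?_⟩, ?_, ?_, ?_, ?_⟩, ?_, ?_, ?_, ?_⟩
  · exact (egf_summ (par_bound 1 bf) hx).of_norm
  · exact (egf_summ (par_bound 0 bf) hx).of_norm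
  · exact (egf_summ (par_bound 1 bg) hx).of_norm
  · exact (egf_summ (par_bound 0 bg) hx).of_norm
  · have := egf_ode (d := fun _ => 0) (par_bound 1 bf) (par_bound 0 bf) (par_bound 0 bf)
      (fun n => by simp) rec_f1 hx
    rw [F1_eq, F2_eq]
    convert this using 1
    simp [egf, sq]
  · have := egf_ode (par_bound 0 bf) (par_bound 0 bf) (par_bound 1 bf) (par_bound 1 bg) rec_f2 hx
    rw [F1_eq, F2_eq, G1_eq, mul_comm]
    exact this
  · have := egf_ode (par_bound 1 bg) (par_bound 0 bf) (par_bound 0 bh) (par_bound 0 bf) rec_g1 hx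
    rw [par_h, egf_sub (par_bound 0 bf) (par_bound 0 bg) hx] at this
    exact this
  · have := egf_ode (par_bound 0 bg) (par_bound 0 bf) (par_bound 1 bh) (par_bound 1 bg) rec_g2 hx
    rw [par_h, egf_sub (par_bound 1 bf) (par_bound 1 bg) hx] at this
    exact this
  · rw [F1_eq, egf_zero]; simp [par]
  · rw [G1_eq, egf_zero]; simp [par]
  · rw [F2_eq, egf_zero]; simp [par, fCount_zero]
  · rw [G2_eq, egf_zero]; simp [par, gCount_zero]
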